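/- Let n ≥ 2 and let A: B → SO(n) be a measurable rotation-valued field on the unit ball B ⊂ ℝ^n such that Curl A is a bounded vector measure with |Curl A|(B) < ∞, and suppose that for every cube Q of side ρ with 4Q ⊂ B there is a rotation R_Q with ‖A − R_Q‖_{L^{1*,∞}(Q)} ≤ C(n)|Curl A|(4Q), 1* = n/(n−1). Then A ∈ BV(B', SO(n)) for every B' compactly contained in B, with |DA|(B') ≤ C'(n)|Curl A|(B). -/

import Mathlib

open MeasureTheory Metric
open scoped NNReal ENNReal

attribute [local instance] Matrix.frobeniusNormedAddCommGroup

noncomputable section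

/-- The half-open axis-parallel cube with lower corner `c` and side `ρ`. -/
def cube {n : ℕ} (c : EuclideanSpace ℝ (Fin n)) (ρ : ℝ) : Set (EuclideanSpace ℝ (Fin n)) :=
  {x | ∀ i, c i ≤ x i ∧ x i < c i + ρ}

/-- The concentric dilation `4Q` of the cube `Q = cube c ρ`. -/
def cube4 {n : ℕ} (c : EuclideanSpace ℝ (Fin n)) (ρ : ℝ) : Set (EuclideanSpace ℝ (Fin n)) :=
  {x | ∀ i, c i - 3 * ρ / 2 ≤ x i ∧ x i < c i - 3 * ρ / 2 + 4 * ρ}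

/-- The weak `L^p` quasi-norm of `f` on the set `E`. -/
def wnorm {n : ℕ} {F : Type*} [NormedAddCommGroup F] (p : ℝ)
    (E : Set (EuclideanSpace ℝ (Fin n))) (f : EuclideanSpace ℝ (Fin n) → F) : ℝ≥0∞ :=
  ⨆ (t : ℝ≥0) (_ : 0 < t), (t : ℝ≥0∞) * (volume {x ∈ E | (t : ℝ) < ‖f x‖}) ^ (1 / p)

/-- The total variation of a vector measure on a set. -/
def tvOn {α M : Type*} [MeasurableSpace α] [NormedAddCommGroup M]
    (μ : VectorMeasure α M) (B : Set α) : ℝ≥0∞ :=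
  ⨆ (s : ℕ → Set α) (_ : ∀ i, MeasurableSet (s i))
    (_ : Pairwise (Function.onFun Disjoint s)) (_ : ∀ i, s i ⊆ B),
    ∑' i, (‖μ (s i)‖₊ : ℝ≥0∞)

/-- The distributional total variation `|Df|(Ω)` of a matrix-valued field. -/
def tvar {n : ℕ} (f : EuclideanSpace ℝ (Fin n) → Matrix (Fin n) (Fin n) ℝ)
    (Ω : Set (EuclideanSpace ℝ (Fin n))) : ℝ≥0∞ :=
  ⨆ (φ : Fin n → Fin n → EuclideanSpace ℝ (Fin n) → EuclideanSpace ℝ (Fin n))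
    (_ : ∀ i j, ContDiff ℝ 1 (φ i j)) (_ : ∀ i j, HasCompactSupport (φ i j))
    (_ : ∀ i j, tsupport (φ i j) ⊆ Ω) (_ : ∀ x, ∑ i, ∑ j, ‖φ i j x‖ ^ 2 ≤ 1),
    ENNReal.ofReal (∫ x in Ω, ∑ i, ∑ j, f x i j *
      ∑ k, fderiv ℝ (φ i j) x (EuclideanSpace.single k 1) k)

/-- `SO(n)` as a set of real `n × n` matrices. -/
def SOset (n : ℕ) : Set (Matrix (Fin n) (Fin n) ℝ) :=
  {Q | Q ∈ Matrix.specialOrthogonalGroup (Fin n) ℝ}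

end

lemma tvOn_mono {α M : Type*} [MeasurableSpace α] [NormedAddCommGroup M]
    (μ : VectorMeasure α M) {B C : Set α} (h : B ⊆ C) : tvOn μ B ≤ tvOn μ C := by
  unfold tvOn
  refine iSup_le fun s => iSup_le fun h1 => iSup_le fun h2 => iSup_le fun h3 => ?_
  exact le_iSup_of_le s (le_iSup_of_le h1 (le_iSup_of_le h2
    (le_iSup_of_le (fun i => (h3 i).trans h) le_rfl)))

lemma tvOn_add_le {α M : Type*} [MeasurableSpace α] [NormedAddCommGroup M]
    (μ : VectorMeasure α M) {B C : Set α} (h : Disjoint B C) :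
    tvOn μ B + tvOn μ C ≤ tvOn μ (B ∪ C) := by
  have e : ∀ D : Set α, tvOn μ D = ⨆ (s : ℕ → Set α) (_ : (∀ i, MeasurableSet (s i)) ∧
      Pairwise (Function.onFun Disjoint s) ∧ (∀ i, s i ⊆ D)), ∑' i, (‖μ (s i)‖₊ : ℝ≥0∞) := by
    intro D; simp only [tvOn, iSup_and]
  have ne : ∀ D : Set α, ∃ s : ℕ → Set α, (∀ i, MeasurableSet (s i)) ∧
      Pairwise (Function.onFun Disjoint s) ∧ (∀ i, s i ⊆ D) := fun D =>
    ⟨fun _ => ∅, fun _ => MeasurableSet.empty, fun i j _ => by simp [Function.onFun], by simp⟩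
  rw [e B, e C]
  refine ENNReal.biSup_add_biSup_le' (ne B) (ne C) ?_
  rintro s ⟨s1, s2, s3⟩ t ⟨t1, t2, t3⟩
  rw [e (B ∪ C)]
  refine le_iSup₂_of_le (fun k => if k % 2 = 0 then s (k / 2) else t (k / 2)) ⟨?_, ?_, ?_⟩ ?_
  · intro i; dsimp only; split_ifs
    exacts [s1 _, t1 _]
  · intro i j hij
    simp only [Function.onFun]
    split_ifs with h1 h2 h2
    · exact s2 (by omega)
    · exact h.mono (s3 _) (t3 _)
    · exact h.symm.mono (t3 _) (s3 _)
    · exact t2 (by omega)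
  · intro i; dsimp only; split_ifs
    exacts [(s3 _).trans Set.subset_union_left, (t3 _).trans Set.subset_union_right]
  · refine le_of_eq (Eq.trans ?_ (tsum_even_add_odd ENNReal.summable ENNReal.summable))
    have h2 : ∀ k, (2 * k + 1) / 2 = k := fun k => by omega
    have h3 : ∀ k, (2 * k + 1) % 2 ≠ 0 := fun k => by omega
    congr 1
    · refine tsum_congr fun k => ?_
      simp
    · refine tsum_congr fun k => ?_
      simp only [if_neg (h3 k), h2]

lemma tvOn_sum_le {α M ι : Type*} [MeasurableSpace α] [NormedAddCommGroup M]
    (μ : VectorMeasure α M) (E : ι → Set α) (s : Finset ι)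
    (h : ∀ i ∈ s, ∀ j ∈ s, i ≠ j → Disjoint (E i) (E j)) :
    ∑ i ∈ s, tvOn μ (E i) ≤ tvOn μ (⋃ i ∈ s, E i) := by
  classical
  induction s using Finset.induction_on with
  | empty => simp
  | insert a s ha ih =>
    rw [Finset.sum_insert ha, Finset.set_biUnion_insert]
    refine le_trans (add_le_add le_rfl (ih fun i hi j hj => h i (Finset.mem_insert_of_mem hi) j
      (Finset.mem_insert_of_mem hj))) (tvOn_add_le μ ?_)
    rw [Set.disjoint_iUnion₂_right]
    intro i hi
    exact h a (Finset.mem_insert_self _ _) i (Finset.mem_insert_of_mem hi)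
      (fun e => ha (e ▸ hi))

lemma tvOn_tsum_le {α M ι : Type*} [MeasurableSpace α] [NormedAddCommGroup M]
    (μ : VectorMeasure α M) (E : ι → Set α) (B : Set α) (hB : ∀ i, E i ⊆ B)
    (h : ∀ i j, i ≠ j → Disjoint (E i) (E j)) :
    ∑' i, tvOn μ (E i) ≤ tvOn μ B := by
  rw [ENNReal.tsum_eq_iSup_sum]
  refine iSup_le fun s => (tvOn_sum_le μ E s fun i _ j _ => h i j).trans (tvOn_mono μ ?_)
  exact Set.iUnion₂_subset fun i _ => hB i

lemma weak_real {α : Type*} [MeasurableSpace α] (μ : Measure α) (n : ℕ) (hn : 2 ≤ n)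
    (F : α → ℝ) (hF : Measurable F) (S : Set α) (l : ℝ) (hl : 0 < l)
    (hV : μ S ≤ ENNReal.ofReal (l ^ n)) (w : ℝ) (hw : 0 < w)
    (h : ∀ t : ℝ≥0, 0 < t → (t : ℝ≥0∞) * (μ {x ∈ S | (t : ℝ) < |F x|}) ^
      (1 / ((n : ℝ) / (n - 1))) ≤ ENNReal.ofReal w) :
    ∫⁻ x in S, ‖F x‖ₑ ∂μ ≤ ENNReal.ofReal (n * w * l) := by
  have hn' : (2 : ℝ) ≤ n := by exact_mod_cast hn
  set p : ℝ := (n : ℝ) / (n - 1) with hp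
  have hp1 : 1 < p := by rw [hp, lt_div_iff₀ (by linarith)]; linarith
  have hp0 : 0 < p := by linarith
  have hpm : (p - 1) * (n - 1) = 1 := by
    have : (n : ℝ) - 1 ≠ 0 := by linarith
    rw [hp, sub_mul, div_mul_cancel₀ _ this]; ring
  have key : ∀ t : ℝ, 0 < t → μ {x ∈ S | t < |F x|} ≤ ENNReal.ofReal (w ^ p * t ^ (-p)) := by
    intro t ht
    have h1 := h t.toNNReal (by simpa using ht)
    rw [Real.coe_toNNReal t ht.le] at h1
    change ENNReal.ofReal t * _ ≤ _ at h1
    rw [mul_comm, ← ENNReal.le_div_iff_mul_le (by left; simpa using ht) (by left; simp),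
      ← ENNReal.ofReal_div_of_pos ht] at h1
    have h2 := ENNReal.rpow_le_rpow h1 hp0.le
    rw [← ENNReal.rpow_mul, one_div, inv_mul_cancel₀ hp0.ne', ENNReal.rpow_one,
      ENNReal.ofReal_rpow_of_pos (by positivity)] at h2
    refine h2.trans (ENNReal.ofReal_le_ofReal ?_)
    rw [Real.div_rpow hw.le ht.le, Real.rpow_neg ht.le, div_eq_mul_inv]
  set T : ℝ := w / l ^ (n - 1 : ℝ) with hT
  have hT0 : 0 < T := by positivity
  have e1 : ∫⁻ x in S, ‖F x‖ₑ ∂μ = ∫⁻ t in Set.Ioi (0:ℝ), μ {x ∈ S | t < |F x|} := by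
    have := lintegral_eq_lintegral_meas_lt (μ.restrict S) (f := fun x => |F x|)
      (Filter.Eventually.of_forall fun x => abs_nonneg _) (hF.abs.aemeasurable)
    simp_rw [Real.enorm_eq_ofReal_abs]
    rw [this]
    refine lintegral_congr fun t => ?_
    rw [Measure.restrict_apply (measurableSet_lt measurable_const hF.abs)]
    congr 1; ext x; simp [and_comm]
  rw [e1, ← Set.Ioc_union_Ioi_eq_Ioi hT0.le]
  refine (lintegral_union_le _ _ _).trans ?_
  have b1 : ∫⁻ t in Set.Ioc 0 T, μ {x ∈ S | t < |F x|} ≤ ENNReal.ofReal (w * l) := by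
    calc _ ≤ ∫⁻ t in Set.Ioc 0 T, ENNReal.ofReal (l ^ n) :=
          lintegral_mono fun t => (measure_mono (Set.sep_subset _ _)).trans hV
      _ = ENNReal.ofReal (l ^ n) * ENNReal.ofReal T := by simp
      _ = ENNReal.ofReal (w * l) := by
          rw [← ENNReal.ofReal_mul (by positivity)]
          congr 1
          rw [hT, Real.rpow_sub hl, Real.rpow_one, Real.rpow_natCast]
          field_simp
  have b2 : ∫⁻ t in Set.Ioi T, μ {x ∈ S | t < |F x|} ≤ ENNReal.ofReal ((n - 1) * w * l) := by
    calc _ ≤ ∫⁻ t in Set.Ioi T, ENNReal.ofReal (w ^ p * t ^ (-p)) :=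
          setLIntegral_mono' measurableSet_Ioi fun t ht => key t (hT0.trans ht)
      _ = ENNReal.ofReal (∫ t in Set.Ioi T, w ^ p * t ^ (-p)) := by
          rw [ofReal_integral_eq_lintegral_ofReal]
          · exact (integrableOn_Ioi_rpow_of_lt (by linarith) hT0).const_mul _
          · filter_upwards [ae_restrict_mem measurableSet_Ioi] with t ht
            have : 0 < t := hT0.trans ht
            simp only [Pi.zero_apply]
            positivity
      _ = ENNReal.ofReal ((n - 1) * w * l) := by
          congr 1
          rw [integral_const_mul, integral_Ioi_rpow_of_lt (by linarith) hT0, hT,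
            Real.div_rpow hw.le (by positivity), ← Real.rpow_mul hl.le,
            show ((n:ℝ) - 1) * (-p + 1) = -1 by linarith, Real.rpow_neg_one,
            Real.rpow_add hw, Real.rpow_neg hw.le, Real.rpow_one]
          have : w ^ p ≠ 0 := by positivity
          have h3 : -p + 1 ≠ 0 := by linarith
          field_simp
          linarith
  refine (add_le_add b1 b2).trans ?_
  rw [← ENNReal.ofReal_add (by positivity) (by have : 0 ≤ (n:ℝ) - 1 := by linarith
                                               positivity)]
  exact ENNReal.ofReal_le_ofReal (by linarith)

lemma weak_enn {α : Type*} [MeasurableSpace α] (μ : Measure α) (n : ℕ) (hn : 2 ≤ n)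
    (F : α → ℝ) (hF : Measurable F) (S : Set α) (l : ℝ) (hl : 0 < l)
    (hV : μ S ≤ ENNReal.ofReal (l ^ n)) (W : ℝ≥0∞)
    (h : ∀ t : ℝ≥0, 0 < t → (t : ℝ≥0∞) * (μ {x ∈ S | (t : ℝ) < |F x|}) ^
      (1 / ((n : ℝ) / (n - 1))) ≤ W) :
    ∫⁻ x in S, ‖F x‖ₑ ∂μ ≤ ENNReal.ofReal (n * l) * W := by
  have hc : 0 < (n : ℝ) * l := by
    have : (0:ℝ) < n := by exact_mod_cast (by omega : 0 < n)
    positivity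
  have hc1 : ENNReal.ofReal (n * l) ≠ 0 := by rw [Ne, ENNReal.ofReal_eq_zero]; linarith
  have hc2 : ENNReal.ofReal (n * l) ≠ ⊤ := ENNReal.ofReal_ne_top
  by_cases hW : W = ⊤
  · rw [hW, ENNReal.mul_top hc1]; exact le_top
  rw [mul_comm, ← ENNReal.div_le_iff_le_mul (Or.inl hc1) (Or.inl hc2)]
  refine ENNReal.le_of_forall_pos_le_add fun ε hε _ => ?_
  rw [ENNReal.div_le_iff_le_mul (Or.inl hc1) (Or.inl hc2)]
  have hw : W ≤ W + ε := le_self_add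
  have e : W + ε = ENNReal.ofReal (W.toReal + ε) := by
    rw [ENNReal.ofReal_add ENNReal.toReal_nonneg (by positivity), ENNReal.ofReal_toReal hW]
    simp
  have h0 : 0 < W.toReal + ε := by positivity
  have := weak_real μ n hn F hF S l hl hV _ h0 fun t ht => (h t ht).trans (hw.trans e.le)
  rw [e, ← ENNReal.ofReal_mul h0.le]
  refine this.trans (ENNReal.ofReal_le_ofReal (by linarith))

lemma cube_eq {n : ℕ} (c : EuclideanSpace ℝ (Fin n)) (ρ : ℝ) :
    cube c ρ = (MeasurableEquiv.toLp 2 (Fin n → ℝ)).symm ⁻¹'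
      (Set.univ.pi fun i => Set.Ico (c i) (c i + ρ)) := by
  ext x; simp [cube]

lemma cube_meas {n : ℕ} (c : EuclideanSpace ℝ (Fin n)) (ρ : ℝ) : MeasurableSet (cube c ρ) := by
  rw [cube_eq]
  exact (MeasurableEquiv.measurable _) (MeasurableSet.univ_pi fun i => measurableSet_Ico)

lemma cube_vol {n : ℕ} (c : EuclideanSpace ℝ (Fin n)) (ρ : ℝ) (hρ : 0 < ρ) :
    volume (cube c ρ) = ENNReal.ofReal (ρ ^ n) := by
  rw [cube_eq, (EuclideanSpace.volume_preserving_symm_measurableEquiv_toLp _).measure_preimage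
    (MeasurableSet.univ_pi fun i => measurableSet_Ico).nullMeasurableSet, Real.volume_pi_Ico]
  simp [ENNReal.ofReal_pow hρ.le]

lemma cell_bound {n : ℕ} (hn : 2 ≤ n) (a : EuclideanSpace ℝ (Fin n) → ℝ) (ha : Measurable a)
    (k : Fin n) (h : ℝ) (hh : 0 < h) (c c' : EuclideanSpace ℝ (Fin n))
    (hc : ∀ i, c' i = c i - h) (r : ℝ) (W : ℝ≥0∞)
    (H : ∀ t : ℝ≥0, 0 < t → (t : ℝ≥0∞) * (volume {x ∈ cube c' (2 * h) | (t : ℝ) < |a x - r|}) ^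
      (1 / ((n : ℝ) / (n - 1))) ≤ W) :
    ∫⁻ x in cube c h, ‖a (x - h • EuclideanSpace.single k (1 : ℝ)) - a x‖ₑ ≤
      ENNReal.ofReal (4 * n * h) * W := by
  set v : EuclideanSpace ℝ (Fin n) := h • EuclideanSpace.single k (1 : ℝ) with hv
  have hvk : ∀ i, 0 ≤ v i ∧ v i ≤ h := by
    intro i
    by_cases hik : i = k
    · subst hik; simp [hv, hh.le]
    · simp [hv, hik, hh.le]
  have h1 := weak_enn volume n hn (fun x => a x - r) (ha.sub_const r) (cube c' (2 * h))
    (2 * h) (by positivity) (cube_vol _ _ (by positivity)).le W H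
  have s1 : cube c h ⊆ cube c' (2 * h) := by
    intro x hx i
    have := hx i; have := hc i
    constructor <;> linarith
  have s2 : ∀ x ∈ cube c h, x - v ∈ cube c' (2 * h) := by
    intro x hx i
    have := hx i; have := hc i; have := hvk i
    simp only [PiLp.sub_apply]
    constructor <;> linarith
  have m1 : Measurable fun x => ‖a x - r‖ₑ := (ha.sub_const r).enorm
  have e2 : ∫⁻ x in cube c h, ‖a (x - v) - r‖ₑ ≤ ∫⁻ x in cube c' (2 * h), ‖a x - r‖ₑ := by
    rw [← lintegral_indicator (cube_meas _ _), ← lintegral_indicator (cube_meas _ _),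
      ← lintegral_sub_right_eq_self ((cube c' (2 * h)).indicator fun x => ‖a x - r‖ₑ) v]
    refine lintegral_mono fun x => ?_
    by_cases hx : x ∈ cube c h
    · rw [Set.indicator_of_mem hx, Set.indicator_of_mem (s2 x hx)]
    · rw [Set.indicator_of_notMem hx]; exact zero_le
  have e3 : ∫⁻ x in cube c h, ‖a x - r‖ₑ ≤ ∫⁻ x in cube c' (2 * h), ‖a x - r‖ₑ :=
    lintegral_mono_set s1
  calc _ ≤ ∫⁻ x in cube c h, (‖a (x - v) - r‖ₑ + ‖a x - r‖ₑ) := by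
        refine lintegral_mono fun x => ?_
        have : a (x - v) - a x = (a (x - v) - r) - (a x - r) := by ring
        rw [this]; exact enorm_sub_le
    _ = _ := lintegral_add_right _ m1
    _ ≤ _ := add_le_add (e2.trans h1) (e3.trans h1)
    _ = _ := by
        rw [← add_mul, ← ENNReal.ofReal_add (by positivity) (by positivity)]
        congr 2; ring

/-- Grid point. -/
noncomputable def gpt {n : ℕ} (h : ℝ) (s : ℝ) (m : Fin n → ℤ) : EuclideanSpace ℝ (Fin n) :=
  WithLp.toLp 2 fun i => h * (m i) - s

lemma cover {n : ℕ} (h : ℝ) (hh : 0 < h) :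
    (⋃ m : Fin n → ℤ, cube (gpt h 0 m) h) = Set.univ := by
  refine Set.eq_univ_of_forall fun x => Set.mem_iUnion.2 ⟨fun i => ⌊x i / h⌋, fun i => ?_⟩
  have h1 := Int.floor_le (x i / h)
  have h2 := Int.lt_floor_add_one (x i / h)
  rw [le_div_iff₀ hh] at h1
  rw [div_lt_iff₀ hh] at h2
  simp only [gpt]
  constructor <;> nlinarith

lemma overlap {n : ℕ} {M : Type*} [NormedAddCommGroup M]
    (μ : VectorMeasure (EuclideanSpace ℝ (Fin n)) M) (h : ℝ) (hh : 0 < h)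
    (B : Set (EuclideanSpace ℝ (Fin n))) (f : (Fin n → ℤ) → ℝ≥0∞) (D : ℝ≥0∞)
    (hf : ∀ m, f m = 0 ∨ (cube4 (gpt h h m) (2 * h) ⊆ B ∧
      f m ≤ D * tvOn μ (cube4 (gpt h h m) (2 * h)))) :
    ∑' m, f m ≤ 8 ^ n * (D * tvOn μ B) := by
  classical
  rw [← ENNReal.tsum_fiberwise f (fun m i => ((m i : ℤ) : ZMod 8))]
  have key : ∀ g : Fin n → ZMod 8,
      ∑' b : ((fun (m : Fin n → ℤ) i => ((m i : ℤ) : ZMod 8)) ⁻¹' {g}), f b ≤ D * tvOn μ B := by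
    intro g
    let E : ((fun (m : Fin n → ℤ) i => ((m i : ℤ) : ZMod 8)) ⁻¹' {g}) →
      Set (EuclideanSpace ℝ (Fin n)) := fun b =>
        if f b = 0 then ∅ else cube4 (gpt h h b.1) (2 * h)
    have hE : ∀ b, E b ⊆ cube4 (gpt h h b.1) (2 * h) := by
      intro b; dsimp only [E]; split_ifs <;> simp
    calc _ ≤ ∑' b, D * tvOn μ (E b) := by
          refine ENNReal.tsum_le_tsum fun b => ?_
          dsimp only [E]
          split_ifs with h0
          · rw [h0]; exact zero_le
          · exact ((hf b).resolve_left h0).2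
      _ = D * ∑' b, tvOn μ (E b) := ENNReal.tsum_mul_left
      _ ≤ _ := by
          gcongr
          refine tvOn_tsum_le μ E B ?_ ?_
          · intro b
            dsimp only [E]
            split_ifs with h0
            · simp
            · exact ((hf b).resolve_left h0).1
          · intro b b' hbb
            refine Disjoint.mono (hE b) (hE b') ?_
            rw [Set.disjoint_left]
            intro x hx hx'
            apply hbb
            ext i
            have e1 : ((b.1 i : ℤ) : ZMod 8) = ((b'.1 i : ℤ) : ZMod 8) :=
              (congrFun b.2 i).trans (congrFun b'.2 i).symm
            rw [ZMod.intCast_eq_intCast_iff] at e1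
            obtain ⟨q, hq⟩ := e1.dvd
            have y := hx i
            have y' := hx' i
            simp only [gpt] at y y'
            have l1 : h * ((b'.1 i : ℝ) - b.1 i) < h * 8 := by linarith
            have l2 : h * ((b.1 i : ℝ) - b'.1 i) < h * 8 := by linarith
            have l1 := lt_of_mul_lt_mul_left l1 hh.le
            have l2 := lt_of_mul_lt_mul_left l2 hh.le
            have l1 : b'.1 i - b.1 i < 8 := by exact_mod_cast l1
            have l2 : b.1 i - b'.1 i < 8 := by exact_mod_cast l2
            push_cast at hq
            omega
  refine (ENNReal.tsum_le_tsum key).trans ?_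
  rw [tsum_fintype]
  simp

lemma eucl_dist_le {n : ℕ} (x y : EuclideanSpace ℝ (Fin n)) (d : ℝ) (hd : 0 ≤ d)
    (h : ∀ i, |x i - y i| ≤ d) : dist x y ≤ n * d := by
  rw [EuclideanSpace.dist_eq]
  refine Real.sqrt_le_iff.2 ⟨by positivity, ?_⟩
  calc ∑ i, dist (x i) (y i) ^ 2 ≤ ∑ i : Fin n, d ^ 2 := by
        refine Finset.sum_le_sum fun i _ => ?_
        rw [Real.dist_eq]
        exact pow_le_pow_left₀ (abs_nonneg _) (h i) 2
    _ = n * d ^ 2 := by simp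
    _ ≤ (n * d) ^ 2 := by
        rw [mul_pow]
        gcongr
        rcases Nat.eq_zero_or_pos n with h0 | h0
        · simp [h0]
        · exact_mod_cast Nat.le_self_pow (by norm_num) n

lemma shift_bound {n : ℕ} (hn : 2 ≤ n) {M : Type*} [NormedAddCommGroup M]
    (μ : VectorMeasure (EuclideanSpace ℝ (Fin n)) M) (Cn : ℝ≥0)
    (a : EuclideanSpace ℝ (Fin n) → ℝ) (ha : Measurable a)
    (B K : Set (EuclideanSpace ℝ (Fin n))) (hB : IsOpen B) (hK : IsCompact K) (hKB : K ⊆ B)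
    (H : ∀ (c : EuclideanSpace ℝ (Fin n)) (ρ : ℝ), 0 < ρ → cube4 c ρ ⊆ B →
      ∃ r : ℝ, ∀ t : ℝ≥0, 0 < t → (t : ℝ≥0∞) * (volume {x ∈ cube c ρ | (t : ℝ) < |a x - r|}) ^
      (1 / ((n : ℝ) / (n - 1))) ≤ Cn * tvOn μ (cube4 c ρ)) (k : Fin n) :
    ∀ᶠ h : ℝ in nhdsWithin 0 (Set.Ioi 0),
      ∫⁻ x in K, ‖a (x - h • EuclideanSpace.single k (1 : ℝ)) - a x‖ₑ ≤
        8 ^ n * (ENNReal.ofReal (4 * n * h) * Cn * tvOn μ B) := by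
  obtain ⟨δ, hδ, hsub⟩ := hK.exists_thickening_subset_open hB hKB
  have hn0 : (0 : ℝ) < n := by exact_mod_cast (by omega : 0 < n)
  have hev : Set.Ioo (0 : ℝ) (δ / (n * 8)) ∈ nhdsWithin (0 : ℝ) (Set.Ioi 0) :=
    Ioo_mem_nhdsGT (by positivity)
  filter_upwards [hev] with h hh
  have h0 : 0 < h := hh.1
  have h1 : n * (8 * h) < δ := by
    have := hh.2
    rw [lt_div_iff₀ (by positivity)] at this
    linarith
  set G : EuclideanSpace ℝ (Fin n) → ℝ≥0∞ :=
    fun x => ‖a (x - h • EuclideanSpace.single k (1 : ℝ)) - a x‖ₑ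
  have hcov : K ⊆ ⋃ m : Fin n → ℤ, (cube (gpt h 0 m) h ∩ K) := by
    rw [← Set.iUnion_inter, cover h h0]; simp
  refine (lintegral_mono_set hcov).trans ((lintegral_iUnion_le _ _).trans ?_)
  refine overlap μ h h0 B _ _ fun m => ?_
  rcases Set.eq_empty_or_nonempty (cube (gpt h 0 m) h ∩ K) with he | ⟨x, hx, hxK⟩
  · left; rw [he]; simp
  right
  have hs : cube4 (gpt h h m) (2 * h) ⊆ B := by
    intro y hy
    refine hsub (Metric.mem_thickening_iff.2 ⟨x, hxK, lt_of_le_of_lt ?_ h1⟩)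
    refine eucl_dist_le y x _ (by positivity) fun i => ?_
    have hxi := hx i
    have hyi := hy i
    simp only [gpt] at hxi hyi
    rw [abs_le]
    constructor <;> linarith
  refine ⟨hs, (lintegral_mono_set Set.inter_subset_left).trans ?_⟩
  obtain ⟨r, hr⟩ := H _ _ (by positivity) hs
  have := cell_bound hn a ha k h h0 (gpt h 0 m) (gpt h h m) (by intro i; simp [gpt]) r _ hr
  rw [mul_assoc]
  exact this

lemma scalar_bound {n : ℕ} (hn : 2 ≤ n) {M : Type*} [NormedAddCommGroup M]
    (μ : VectorMeasure (EuclideanSpace ℝ (Fin n)) M) (Cn : ℝ≥0)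
    (a : EuclideanSpace ℝ (Fin n) → ℝ) (ha : Measurable a) (hai : Integrable a)
    (B : Set (EuclideanSpace ℝ (Fin n))) (hB : IsOpen B)
    (H : ∀ (c : EuclideanSpace ℝ (Fin n)) (ρ : ℝ), 0 < ρ → cube4 c ρ ⊆ B →
      ∃ r : ℝ, ∀ t : ℝ≥0, 0 < t → (t : ℝ≥0∞) * (volume {x ∈ cube c ρ | (t : ℝ) < |a x - r|}) ^
      (1 / ((n : ℝ) / (n - 1))) ≤ Cn * tvOn μ (cube4 c ρ)) (k : Fin n)
    (ψ : EuclideanSpace ℝ (Fin n) → ℝ) (hψ : ContDiff ℝ 1 ψ) (hc : HasCompactSupport ψ)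
    (hs : tsupport ψ ⊆ B) (hb : ∀ x, |ψ x| ≤ 1) :
    ‖∫ x, fderiv ℝ ψ x (EuclideanSpace.single k 1) * a x‖ₑ ≤
      8 ^ n * (ENNReal.ofReal (4 * n) * Cn * tvOn μ B) := by
  obtain ⟨L, hL⟩ := hψ.lipschitzWith_of_hasCompactSupport hc one_ne_zero
  have T := hL.integral_inv_smul_sub_mul_tendsto_integral_lineDeriv_mul hai
    (EuclideanSpace.single k (1 : ℝ))
  have e0 : ∀ x, lineDeriv ℝ ψ x (EuclideanSpace.single k 1) =
      fderiv ℝ ψ x (EuclideanSpace.single k 1) := fun x =>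
    ((hψ.differentiable one_ne_zero) x).lineDeriv_eq_fderiv
  simp_rw [e0] at T
  refine le_of_tendsto T.enorm ?_
  filter_upwards [shift_bound hn μ Cn a ha B _ hB hc hs H k, self_mem_nhdsWithin] with h hh h0
  have h0 : 0 < h := h0
  set v : EuclideanSpace ℝ (Fin n) := h • EuclideanSpace.single k (1 : ℝ) with hv
  have hψm : AEStronglyMeasurable ψ volume := hψ.continuous.aestronglyMeasurable
  have i1 : Integrable fun x => ψ x * a x :=
    hai.bdd_mul hψm (c := 1) (Filter.Eventually.of_forall fun x => by simpa using hb x)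
  have i2 : Integrable fun x => ψ x * a (x - v) :=
    (hai.comp_sub_right v).bdd_mul hψm (c := 1)
      (Filter.Eventually.of_forall fun x => by simpa using hb x)
  have i3 : Integrable fun x => ψ (x + v) * a x := by
    have := i2.comp_add_right v
    simpa using this
  have e1 : ∫ x, h⁻¹ • (ψ (x + v) - ψ x) * a x =
      h⁻¹ * ∫ x, ψ x * (a (x - v) - a x) := by
    have e2 : ∫ x, ψ (x + v) * a x = ∫ x, ψ x * a (x - v) := by
      rw [← integral_add_right_eq_self (fun x => ψ x * a (x - v)) v]
      simp
    simp_rw [smul_eq_mul, mul_assoc, integral_const_mul, sub_mul, mul_sub]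
    rw [integral_sub i3 i1, integral_sub i2 i1, e2]
  rw [e1, enorm_mul]
  have e3 : ‖∫ x, ψ x * (a (x - v) - a x)‖ₑ ≤ ∫⁻ x in tsupport ψ, ‖a (x - v) - a x‖ₑ := by
    refine (enorm_integral_le_lintegral_enorm _).trans ?_
    rw [← lintegral_indicator (isClosed_tsupport ψ).measurableSet]
    refine lintegral_mono fun x => ?_
    by_cases hx : x ∈ tsupport ψ
    · rw [Set.indicator_of_mem hx, enorm_mul]
      refine mul_le_of_le_one_left' ?_
      rw [Real.enorm_eq_ofReal_abs]
      exact ENNReal.ofReal_le_one.2 (hb x)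
    · rw [image_eq_zero_of_notMem_tsupport hx]; simp
  refine (mul_le_mul_right (e3.trans hh) _).trans ?_
  rw [Real.enorm_eq_ofReal_abs, abs_of_pos (inv_pos.2 h0), ENNReal.ofReal_mul (by positivity)]
  have e4 : ENNReal.ofReal h⁻¹ * ENNReal.ofReal h = 1 := by
    rw [← ENNReal.ofReal_mul (by positivity), inv_mul_cancel₀ h0.ne']; simp
  refine le_of_eq ?_
  calc _ = (ENNReal.ofReal h⁻¹ * ENNReal.ofReal h) *
        (8 ^ n * (ENNReal.ofReal (4 * n) * Cn * tvOn μ B)) := by ring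
    _ = _ := by rw [e4, one_mul]

lemma frob_entry {n : ℕ} (X : Matrix (Fin n) (Fin n) ℝ) (i j : Fin n) : |X i j| ≤ ‖X‖ := by
  rw [Matrix.frobenius_norm_def, ← Real.sqrt_eq_rpow]
  refine Real.le_sqrt_of_sq_le ?_
  simp only [Real.norm_eq_abs, Real.rpow_two]
  refine le_trans ?_ (Finset.single_le_sum (f := fun i => ∑ j, |X i j| ^ 2)
    (fun i _ => Finset.sum_nonneg fun j _ => by positivity) (Finset.mem_univ i))
  exact Finset.single_le_sum (f := fun j => |X i j| ^ 2)
    (fun j _ => by positivity) (Finset.mem_univ j)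

lemma so_entry {n : ℕ} {X : Matrix (Fin n) (Fin n) ℝ} (h : X ∈ SOset n) (i j : Fin n) :
    ‖X i j‖ ≤ 1 :=
  entry_norm_bound_of_unitary (Matrix.mem_specialOrthogonalGroup_iff.1 h).1 i j

theorem bv_bound_of_curl_for_rotation_fields (n : ℕ) (hn : 2 ≤ n) (Cn : ℝ≥0) :
    ∃ C' : ℝ≥0, 0 < C' ∧
    ∀ (A : EuclideanSpace ℝ (Fin n) → Matrix (Fin n) (Fin n) ℝ),
      (∀ i j, Measurable fun x => A x i j) →
      (∀ᵐ x ∂(volume.restrict (ball (0 : EuclideanSpace ℝ (Fin n)) 1)), A x ∈ SOset n) →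
    ∀ (curlA : VectorMeasure (EuclideanSpace ℝ (Fin n))
        (EuclideanSpace ℝ (Fin n × Fin n × Fin n))),
      tvOn curlA Set.univ < ⊤ →
      (∀ (c : EuclideanSpace ℝ (Fin n)) (ρ : ℝ), 0 < ρ →
        cube4 c ρ ⊆ ball (0 : EuclideanSpace ℝ (Fin n)) 1 →
        ∃ R ∈ SOset n, wnorm ((n : ℝ) / (n - 1)) (cube c ρ) (fun x => A x - R)
          ≤ (Cn : ℝ≥0∞) * tvOn curlA (cube4 c ρ)) →
    ∀ B' : Set (EuclideanSpace ℝ (Fin n)),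
      B' ⊆ ball (0 : EuclideanSpace ℝ (Fin n)) 1 →
      closure B' ⊆ ball (0 : EuclideanSpace ℝ (Fin n)) 1 →
      tvar A B' < ⊤ ∧
        tvar A B' ≤ (C' : ℝ≥0∞) * tvOn curlA (ball (0 : EuclideanSpace ℝ (Fin n)) 1) := by
  classical
  set D : ℝ≥0 := 8 ^ n * ((4 * n : ℝ≥0) * Cn) with hD
  refine ⟨(n * (n * (n * D)) : ℝ≥0) + 1, by positivity, ?_⟩
  intro A hA hSO curlA hfin H B' hB' _
  set B : Set (EuclideanSpace ℝ (Fin n)) := ball 0 1 with hBdef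
  have hBfin : tvOn curlA B < ⊤ := (tvOn_mono curlA (Set.subset_univ _)).trans_lt hfin
  suffices hmain : tvar A B' ≤ (((n * (n * (n * D)) : ℝ≥0) + 1 : ℝ≥0) : ℝ≥0∞) * tvOn curlA B from
    ⟨hmain.trans_lt (ENNReal.mul_lt_top ENNReal.coe_lt_top hBfin), hmain⟩
  refine le_trans ?_ (mul_le_mul_left (ENNReal.coe_le_coe.2 le_self_add) _)
  unfold tvar
  refine iSup_le fun φ => iSup_le fun hφ => iSup_le fun hφc => iSup_le fun hφs =>
    iSup_le fun hφb => ?_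
  set a : Fin n → Fin n → EuclideanSpace ℝ (Fin n) → ℝ :=
    fun i j => B.indicator fun x => A x i j with hadef
  have ham : ∀ i j, Measurable (a i j) := fun i j => (hA i j).indicator measurableSet_ball
  have hai : ∀ i j, Integrable (a i j) := by
    intro i j
    refine IntegrableOn.integrable_indicator ?_ measurableSet_ball
    refine Measure.integrableOn_of_bounded (M := 1) measure_ball_lt_top.ne
      (hA i j).aestronglyMeasurable ?_
    filter_upwards [hSO] with x hx
    exact so_entry hx i j
  have hH : ∀ i j, ∀ (c : EuclideanSpace ℝ (Fin n)) (ρ : ℝ), 0 < ρ → cube4 c ρ ⊆ B →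
      ∃ r : ℝ, ∀ t : ℝ≥0, 0 < t →
      (t : ℝ≥0∞) * (volume {x ∈ cube c ρ | (t : ℝ) < |a i j x - r|}) ^
      (1 / ((n : ℝ) / (n - 1))) ≤ Cn * tvOn curlA (cube4 c ρ) := by
    intro i j c ρ hρ hc
    obtain ⟨R, _, hR⟩ := H c ρ hρ hc
    refine ⟨R i j, fun t ht => le_trans ?_ hR⟩
    unfold wnorm
    refine le_iSup₂_of_le t ht ?_
    have hn' : (2 : ℝ) ≤ n := by exact_mod_cast hn
    refine mul_le_mul_right (ENNReal.rpow_le_rpow (measure_mono ?_)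
      (one_div_nonneg.2 (div_nonneg (by linarith) (by linarith)))) _
    rintro x ⟨hx, hxt⟩
    refine ⟨hx, hxt.trans_le ?_⟩
    have hxB : x ∈ B := hc fun i => ⟨by have := hx i; linarith, by have := hx i; linarith⟩
    simp only [hadef, Set.indicator_of_mem hxB]
    exact frob_entry (A x - R) i j
  set ψ : Fin n → Fin n → Fin n → EuclideanSpace ℝ (Fin n) → ℝ := fun i j k x => φ i j x k
    with hψdef
  have hψ : ∀ i j k, ContDiff ℝ 1 (ψ i j k) := fun i j k =>
    (EuclideanSpace.proj (𝕜 := ℝ) k).contDiff.comp (hφ i j)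
  have hψs : ∀ i j k, tsupport (ψ i j k) ⊆ tsupport (φ i j) := by
    intro i j k
    refine closure_mono fun x hx hx0 => hx ?_
    simp [hψdef, hx0]
  have hψc : ∀ i j k, HasCompactSupport (ψ i j k) := fun i j k =>
    (hφc i j).of_isClosed_subset (isClosed_tsupport _) (hψs i j k)
  have hψb : ∀ i j k x, |ψ i j k x| ≤ 1 := by
    intro i j k x
    have h1 : ‖φ i j x‖ ^ 2 ≤ 1 := by
      refine le_trans ?_ (hφb x)
      refine le_trans ?_ (Finset.single_le_sum (f := fun i => ∑ j, ‖φ i j x‖ ^ 2)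
        (fun i _ => Finset.sum_nonneg fun j _ => by positivity) (Finset.mem_univ i))
      exact Finset.single_le_sum (f := fun j => ‖φ i j x‖ ^ 2)
        (fun j _ => by positivity) (Finset.mem_univ j)
    have h2 : |ψ i j k x| ≤ ‖φ i j x‖ := PiLp.norm_apply_le (φ i j x) k
    refine h2.trans ?_
    nlinarith [norm_nonneg (φ i j x)]
  have hd : ∀ i j k x, fderiv ℝ (φ i j) x (EuclideanSpace.single k 1) k =
      fderiv ℝ (ψ i j k) x (EuclideanSpace.single k 1) := by
    intro i j k x
    have := (EuclideanSpace.proj (𝕜 := ℝ) (ι := Fin n) k).hasFDerivAt.comp x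
      ((hφ i j).differentiable one_ne_zero x).hasFDerivAt
    have h2 : fderiv ℝ (ψ i j k) x = _ := this.fderiv
    rw [h2]; rfl
  have hz : ∀ i j k x, x ∉ B' → fderiv ℝ (ψ i j k) x = 0 := by
    intro i j k x hx
    by_contra h0
    exact hx (hφs i j (hψs i j k (tsupport_fderiv_subset ℝ (subset_tsupport _ h0))))
  simp_rw [hd]
  rw [setIntegral_eq_integral_of_forall_compl_eq_zero (by
    intro x hx
    simp [hz _ _ _ x hx])]
  have e1 : ∀ x, ∑ i, ∑ j, A x i j * ∑ k, fderiv ℝ (ψ i j k) x (EuclideanSpace.single k 1) =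
      ∑ i, ∑ j, ∑ k, fderiv ℝ (ψ i j k) x (EuclideanSpace.single k 1) * a i j x := by
    intro x
    refine Finset.sum_congr rfl fun i _ => Finset.sum_congr rfl fun j _ => ?_
    rw [Finset.mul_sum]
    refine Finset.sum_congr rfl fun k _ => ?_
    by_cases hx : x ∈ B
    · simp only [hadef, Set.indicator_of_mem hx]; ring
    · rw [hz i j k x fun h => hx (hB' h)]; simp
  have hint : ∀ i j k, Integrable fun x =>
      fderiv ℝ (ψ i j k) x (EuclideanSpace.single k 1) * a i j x := by
    intro i j k
    obtain ⟨L, hL⟩ := (hψ i j k).lipschitzWith_of_hasCompactSupport (hψc i j k) one_ne_zero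
    refine (hai i j).bdd_mul (c := L * ‖(EuclideanSpace.single k (1 : ℝ) :
      EuclideanSpace ℝ (Fin n))‖) ?_ (Filter.Eventually.of_forall fun x => ?_)
    · exact (((hψ i j k).continuous_fderiv one_ne_zero).clm_apply
        continuous_const).aestronglyMeasurable
    · exact ContinuousLinearMap.le_of_opNorm_le _ (norm_fderiv_le_of_lipschitz ℝ hL) _
  simp_rw [e1]
  rw [integral_finsetSum _ fun i _ => integrable_finsetSum _ fun j _ =>
    integrable_finsetSum _ fun k _ => hint i j k]
  have e2 : ∀ i j k, ‖∫ x, fderiv ℝ (ψ i j k) x (EuclideanSpace.single k 1) * a i j x‖ₑ ≤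
      D * tvOn curlA B := by
    intro i j k
    refine (scalar_bound hn curlA Cn (a i j) (ham i j) (hai i j) B isOpen_ball (hH i j) k
      (ψ i j k) (hψ i j k) (hψc i j k) (((hψs i j k).trans (hφs i j)).trans hB')
      (hψb i j k)).trans (le_of_eq ?_)
    rw [hD, ENNReal.ofReal_mul (by norm_num)]
    push_cast
    simp
    ring
  refine (Real.ofReal_le_enorm _).trans ?_
  refine (enorm_sum_le _ _).trans ?_
  calc _ ≤ ∑ i : Fin n, ∑ j : Fin n, ∑ k : Fin n, (D * tvOn curlA B) := by
        refine Finset.sum_le_sum fun i _ => ?_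
        rw [integral_finsetSum _ fun j _ => integrable_finsetSum _ fun k _ => hint i j k]
        refine (enorm_sum_le _ _).trans (Finset.sum_le_sum fun j _ => ?_)
        rw [integral_finsetSum _ fun k _ => hint i j k]
        exact (enorm_sum_le _ _).trans (Finset.sum_le_sum fun k _ => e2 i j k)
    _ = _ := by
        simp
        ring
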